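/- Let a(n) be the number of Dyck paths of semi-length n with no peak whose height lies in {2,5} and no valley whose height lies in {1,4}, let f = \sum_{n\ge 0} a(n) x^n, and let C = \sum_{n\ge 0} Catalan(n) x^n be the generating function of the Catalan numbers, both in the ring of formal power series over the integers. Then ((x^3 - x^2) C - 2x^3 + 3x^2 - 3x + 1) \cdot f = -x^2 C + x^2 - 2x + 1. -/

import Mathlib

open Finset PowerSeries

/-- A word over the step alphabet (`true` = U = (1,1), `false` = D = (1,-1)) is a
Dyck path if it has equally many U's and D's and every prefix has at least as
many U's as D's (i.e. the lattice path never goes below the x-axis). -/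
def IsDyck (w : List Bool) : Prop :=
  w.count true = w.count false ∧
    ∀ k, (w.take k).count false ≤ (w.take k).count true
/-- The height (y-coordinate) of the lattice point reached after the first `k` steps. -/
def ht (w : List Bool) (k : ℕ) : ℕ :=
  (w.take k).count true - (w.take k).count false
/-- The word `w` has a peak (an occurrence of the factor `UD`) at position `i`;
the height of this peak is `ht w (i+1)`. -/
def IsPeakAt (w : List Bool) (i : ℕ) : Prop :=
  w[i]? = some true ∧ w[i + 1]? = some false
/-- The word `w` has a valley (an occurrence of the factor `DU`) at position `i`;
the height of this valley is `ht w (i+1)`. -/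
def IsValleyAt (w : List Bool) (i : ℕ) : Prop :=
  w[i]? = some false ∧ w[i + 1]? = some true

open BinaryTree

/-- `Admissible h w`: started at height `h`, the word `w` has no peak of height `2` or `5` and
no valley of height `1` or `4`. -/
def Admissible : ℤ → List Bool → Prop
  | _, [] => True
  | h, true :: w => (w.head? = some false → h + 1 ≠ 2 ∧ h + 1 ≠ 5) ∧ Admissible (h + 1) w
  | h, false :: w => (w.head? = some true → h - 1 ≠ 1 ∧ h - 1 ≠ 4) ∧ Admissible (h - 1) w

/-- The signed height change along the first `k` steps of `w`. -/
def signedHeight (w : List Bool) (k : ℕ) : ℤ :=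
  (w.take k).count true - (w.take k).count false

theorem admissible_iff_forall (w : List Bool) (h : ℤ) :
    Admissible h w ↔ ∀ i,
      (IsPeakAt w i → h + signedHeight w (i + 1) ≠ 2 ∧ h + signedHeight w (i + 1) ≠ 5) ∧
      (IsValleyAt w i → h + signedHeight w (i + 1) ≠ 1 ∧ h + signedHeight w (i + 1) ≠ 4) := by
  induction w generalizing h with
  | nil => simp [Admissible, IsPeakAt, IsValleyAt]
  | cons b w ih =>
    rw [← Nat.and_forall_add_one]
    cases b
    · have shift : ∀ i, h + signedHeight (false :: w) (i + 1 + 1) =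
          h - 1 + signedHeight w (i + 1) := by
        intro i; simp [signedHeight]; ring
      simp only [shift, Admissible, ih (h - 1)]
      refine and_congr ?_ (forall_congr' fun i => ?_)
      · simp [IsPeakAt, IsValleyAt, signedHeight, List.head?_eq_getElem?, sub_eq_add_neg]
      · simp [IsPeakAt, IsValleyAt]
    · have shift : ∀ i, h + signedHeight (true :: w) (i + 1 + 1) =
          h + 1 + signedHeight w (i + 1) := by
        intro i; simp [signedHeight]; ring
      simp only [shift, Admissible, ih (h + 1)]
      refine and_congr ?_ (forall_congr' fun i => ?_)
      · simp [IsPeakAt, IsValleyAt, signedHeight, List.head?_eq_getElem?]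
      · simp [IsPeakAt, IsValleyAt]

theorem IsDyck.admissible_iff {w : List Bool} (hw : IsDyck w) :
    Admissible 0 w ↔ (∀ i, IsPeakAt w i → ht w (i + 1) ∉ ({2, 5} : Set ℕ)) ∧
      (∀ i, IsValleyAt w i → ht w (i + 1) ∉ ({1, 4} : Set ℕ)) := by
  have ht_cast : ∀ k, signedHeight w k = (ht w k : ℤ) := fun k => by
    rw [ht, Nat.cast_sub (hw.2 k), signedHeight]
  rw [admissible_iff_forall, ← forall_and]
  simp only [ht_cast, zero_add, Set.mem_insert_iff, Set.mem_singleton_iff, not_or]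
  norm_cast

/-- The word in the alphabet `Bool` of the Dyck path encoded by a binary tree. -/
def treeWord (t : BinaryTree Unit) : List Bool :=
  (DyckWord.ofTree t).toList.map fun s => decide (s = DyckStep.U)

@[simp]
theorem treeWord_nil : treeWord nil = [] := rfl

@[simp]
theorem treeWord_node (u : Unit) (l r : BinaryTree Unit) :
    treeWord (node u l r) = true :: (treeWord l ++ false :: treeWord r) := by
  change List.map _ ([DyckStep.U] ++ (DyckWord.ofTree l).toList ++ [DyckStep.D] ++
    (DyckWord.ofTree r).toList) = _
  simp [treeWord]

theorem count_true_map (l : List DyckStep) :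
    (l.map fun s => decide (s = DyckStep.U)).count true = l.count DyckStep.U := by
  induction l with
  | nil => rfl
  | cons s l ih => cases s <;> simp [ih]

theorem count_false_map (l : List DyckStep) :
    (l.map fun s => decide (s = DyckStep.U)).count false = l.count DyckStep.D := by
  induction l with
  | nil => rfl
  | cons s l ih => cases s <;> simp [ih]

theorem isDyck_treeWord (t : BinaryTree Unit) : IsDyck (treeWord t) := by
  refine ⟨?_, fun k => ?_⟩
  · rw [treeWord, count_true_map, count_false_map, DyckWord.count_U_eq_count_D]
  · rw [treeWord, ← List.map_take, count_true_map, count_false_map]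
    exact DyckWord.count_D_le_count_U _ k

theorem count_true_treeWord (t : BinaryTree Unit) : (treeWord t).count true = t.numNodes := by
  rw [treeWord, count_true_map, ← DyckWord.semilength, ← DyckWord.numNodes_toTree,
    DyckWord.toTree_ofTree]

theorem treeWord_injective : Function.Injective treeWord := by
  have map_inj : Function.Injective fun s : DyckStep => decide (s = DyckStep.U) := by
    intro s t; cases s <;> cases t <;> simp
  intro s t hst
  exact DyckWord.equivTree.symm.injective
    (DyckWord.ext (List.map_injective_iff.2 map_inj hst))

theorem IsDyck.exists_treeWord {w : List Bool} (hw : IsDyck w) : ∃ t, treeWord t = w := by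
  have map_map : (w.map fun b => if b then DyckStep.U else DyckStep.D).map
      (fun s => decide (s = DyckStep.U)) = w := by
    rw [List.map_map]
    conv_rhs => rw [← List.map_id w]
    refine List.map_congr_left fun b _ => ?_
    cases b <;> simp
  let p : DyckWord :=
    { toList := w.map fun b => if b then DyckStep.U else DyckStep.D
      count_U_eq_count_D := by
        rw [← count_true_map, ← count_false_map, map_map, hw.1]
      count_D_le_count_U := fun i => by
        rw [← count_true_map, ← count_false_map, List.map_take, map_map]
        exact hw.2 i }
  exact ⟨p.toTree, by rw [treeWord, DyckWord.ofTree_toTree]; exact map_map⟩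

/-- The condition on a binary tree that its Dyck path, started at height `h`, is admissible. -/
def TreeAdmissible : ℤ → BinaryTree Unit → Prop
  | _, nil => True
  | h, node _ l r => (l = nil → h + 1 ≠ 2 ∧ h + 1 ≠ 5) ∧ (r ≠ nil → h ≠ 1 ∧ h ≠ 4) ∧
      TreeAdmissible (h + 1) l ∧ TreeAdmissible h r

theorem admissible_treeWord_append (t : BinaryTree Unit) (h : ℤ) (v : List Bool)
    (hv : v.head? ≠ some true) :
    Admissible h (treeWord t ++ v) ↔ TreeAdmissible h t ∧ Admissible h v := by
  induction t generalizing h v with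
  | nil => simp [TreeAdmissible]
  | node u l r ihl ihr =>
    have head_left : (treeWord l ++ false :: (treeWord r ++ v)).head? = some false ↔ l = nil := by
      cases l <;> simp
    have head_right : (treeWord r ++ v).head? = some true ↔ r ≠ nil := by
      cases r <;> simp [hv]
    rw [treeWord_node, List.cons_append, List.append_assoc, List.cons_append, Admissible,
      head_left, ihl _ _ (by simp), Admissible, head_right, add_sub_cancel_right, ihr _ _ hv,
      TreeAdmissible]
    tauto

theorem admissible_treeWord (t : BinaryTree Unit) (h : ℤ) :
    Admissible h (treeWord t) ↔ TreeAdmissible h t := by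
  simpa [Admissible] using admissible_treeWord_append t h [] (by simp)

theorem treeAdmissible_of_five_le (t : BinaryTree Unit) {h : ℤ} (hh : 5 ≤ h) :
    TreeAdmissible h t := by
  induction t generalizing h with
  | nil => trivial
  | node u l r ihl ihr =>
    exact ⟨fun _ => by lia, fun _ => by lia, ihl (by lia), ihr hh⟩

open scoped Classical in
/-- The generating function, by number of nodes, of the binary trees satisfying `P`. -/
noncomputable def treeSeries (P : BinaryTree Unit → Prop) : PowerSeries ℤ :=
  PowerSeries.mk fun n => (#{t ∈ treesOfNumNodesEq n | P t} : ℤ)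

theorem treeSeries_node {P Q R : BinaryTree Unit → Prop} (hnil : P nil)
    (hnode : ∀ u l r, P (node u l r) ↔ Q l ∧ R r) :
    treeSeries P = 1 + PowerSeries.X * (treeSeries Q * treeSeries R) := by
  classical
  ext n
  cases n with
  | zero => simp [treeSeries, hnil, Finset.filter_singleton]
  | succ n =>
    rw [map_add, PowerSeries.coeff_succ_X_mul, PowerSeries.coeff_mul, PowerSeries.coeff_one,
      if_neg n.succ_ne_zero, zero_add]
    simp only [treeSeries, PowerSeries.coeff_mk]
    rw [treesOfNumNodesEq_succ, Finset.filter_biUnion, Finset.card_biUnion]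
    · push_cast
      refine Finset.sum_congr rfl fun ij _ => ?_
      rw [Finset.filter_map, Finset.card_map, ← Nat.cast_mul, ← Finset.card_product,
        ← Finset.filter_product]
      congr 2
      exact Finset.filter_congr fun lr _ => hnode () lr.1 lr.2
    · intro ij _ kl _ hne
      rw [Function.onFun, Finset.disjoint_left]
      aesop

theorem treeSeries_eq_nil : treeSeries (· = nil) = 1 := by
  classical
  ext n
  cases n with
  | zero => simp [treeSeries, Finset.filter_singleton]
  | succ n =>
    simp only [treeSeries, PowerSeries.coeff_mk, PowerSeries.coeff_one, if_neg n.succ_ne_zero,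
      Nat.cast_eq_zero, Finset.card_eq_zero]
    refine Finset.filter_eq_empty_iff.2 fun t ht htn => ?_
    subst htn
    simp at ht

theorem treeSeries_ne_nil_and {P : BinaryTree Unit → Prop} (hnil : P nil) :
    treeSeries (fun t => t ≠ nil ∧ P t) = treeSeries P - 1 := by
  classical
  rw [← treeSeries_eq_nil, eq_sub_iff_add_eq]
  ext n
  simp only [treeSeries, map_add, PowerSeries.coeff_mk]
  rw [← Nat.cast_add, ← Finset.card_union_of_disjoint]
  · rw [← Finset.filter_or]
    congr 3
    ext t
    by_cases ht : t = nil <;> simp [ht, hnil]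
  · refine Finset.disjoint_filter.2 ?_
    tauto

theorem treeSeries_eq_catalan {P : BinaryTree Unit → Prop} (hP : ∀ t, P t) :
    treeSeries P = PowerSeries.mk fun n => (catalan n : ℤ) := by
  simp [treeSeries, hP, treesOfNumNodesEq_card_eq_catalan]

theorem treeSeries_treeAdmissible {h : ℤ} (hpeak : h + 1 ≠ 2 ∧ h + 1 ≠ 5)
    (hvalley : h ≠ 1 ∧ h ≠ 4) :
    treeSeries (TreeAdmissible h) =
      1 + PowerSeries.X * (treeSeries (TreeAdmissible (h + 1)) * treeSeries (TreeAdmissible h)) :=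
  treeSeries_node trivial fun u l r => by simp [TreeAdmissible, hpeak, hvalley]

/-- Neither peaks at height `h + 1` nor valleys at height `h` are allowed. -/
theorem treeSeries_treeAdmissible_of_forbidden {h : ℤ} (hpeak : h + 1 = 2 ∨ h + 1 = 5)
    (hvalley : h = 1 ∨ h = 4) :
    treeSeries (TreeAdmissible h) =
      1 + PowerSeries.X * (treeSeries (TreeAdmissible (h + 1)) - 1) := by
  rw [← treeSeries_ne_nil_and (P := TreeAdmissible (h + 1)) trivial]
  suffices node_iff : ∀ u l r, TreeAdmissible h (node u l r) ↔
      (l ≠ nil ∧ TreeAdmissible (h + 1) l) ∧ r = nil by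
    rw [treeSeries_node (P := TreeAdmissible h) trivial node_iff, treeSeries_eq_nil, mul_one]
  intro u l r
  have not_peak : ¬(h + 1 ≠ 2 ∧ h + 1 ≠ 5) := by tauto
  have not_valley : ¬(h ≠ 1 ∧ h ≠ 4) := by tauto
  have nil_admissible : r = nil → TreeAdmissible h r := by rintro rfl; trivial
  simp only [TreeAdmissible, not_peak, not_valley]
  tauto

theorem card_admissible_dyck (n : ℕ) :
    ((Nat.card {w : List Bool // IsDyck w ∧ w.count true = n ∧
      (∀ i, IsPeakAt w i → ht w (i + 1) ∉ ({2, 5} : Set ℕ)) ∧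
      (∀ i, IsValleyAt w i → ht w (i + 1) ∉ ({1, 4} : Set ℕ))} : ℕ) : ℤ) =
      PowerSeries.coeff n (treeSeries (TreeAdmissible 0)) := by
  classical
  rw [treeSeries, PowerSeries.coeff_mk, ← Nat.card_eq_finsetCard, Nat.cast_inj]
  have mem_iff : ∀ t, t ∈ ({t ∈ treesOfNumNodesEq n | TreeAdmissible 0 t} : Finset _) ↔
      (treeWord t).count true = n ∧
        (∀ i, IsPeakAt (treeWord t) i → ht (treeWord t) (i + 1) ∉ ({2, 5} : Set ℕ)) ∧
        (∀ i, IsValleyAt (treeWord t) i → ht (treeWord t) (i + 1) ∉ ({1, 4} : Set ℕ)) := by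
    intro t
    rw [Finset.mem_filter, mem_treesOfNumNodesEq, count_true_treeWord,
      ← (isDyck_treeWord t).admissible_iff, admissible_treeWord]
  refine (Nat.card_congr (Equiv.ofBijective
    (fun t => ⟨treeWord t.1, isDyck_treeWord t.1, (mem_iff t.1).1 t.2⟩) ⟨?_, ?_⟩)).symm
  · intro s t hst
    exact Subtype.ext (treeWord_injective (congrArg Subtype.val hst))
  · rintro ⟨w, hw, hcond⟩
    obtain ⟨t, rfl⟩ := hw.exists_treeWord
    exact ⟨⟨t, (mem_iff t).2 hcond⟩, rfl⟩

/-- With `a n` counting Dyck paths of semi-length `n` with no peak of height in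
`{2, 5}` and no valley of height in `{1, 4}`, `f = ∑ a(n) xⁿ`, and
`C = ∑ Catalan(n) xⁿ` the Catalan generating function, all over `ℤ`, we have
`((x³ - x²) C - 2x³ + 3x² - 3x + 1) f = -x² C + x² - 2x + 1`. -/
theorem statement12 (a : ℕ → ℕ)
    (ha : ∀ n, a n = Nat.card {w : List Bool // IsDyck w ∧ w.count true = n ∧
      (∀ i, IsPeakAt w i → ht w (i + 1) ∉ ({2, 5} : Set ℕ)) ∧
      (∀ i, IsValleyAt w i → ht w (i + 1) ∉ ({1, 4} : Set ℕ))})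
    (f C : PowerSeries ℤ) (hf : f = PowerSeries.mk fun n => (a n : ℤ))
    (hC : C = PowerSeries.mk fun n => (catalan n : ℤ)) :
    ((PowerSeries.X ^ 3 - PowerSeries.X ^ 2) * C - 2 * PowerSeries.X ^ 3 +
        3 * PowerSeries.X ^ 2 - 3 * PowerSeries.X + 1) * f =
      -PowerSeries.X ^ 2 * C + PowerSeries.X ^ 2 - 2 * PowerSeries.X + 1 := by
  have hf' : f = treeSeries (TreeAdmissible 0) := by
    ext n
    rw [hf, PowerSeries.coeff_mk, ha, card_admissible_dyck]
  have h0 := treeSeries_treeAdmissible (h := 0) (by norm_num) (by norm_num)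
  have h1 := treeSeries_treeAdmissible_of_forbidden (h := 1) (by norm_num) (by norm_num)
  have h2 := treeSeries_treeAdmissible (h := 2) (by norm_num) (by norm_num)
  have h3 := treeSeries_treeAdmissible (h := 3) (by norm_num) (by norm_num)
  have h4 := treeSeries_treeAdmissible_of_forbidden (h := 4) (by norm_num) (by norm_num)
  have h5 := treeSeries_eq_catalan fun t => treeAdmissible_of_five_le t le_rfl
  norm_num at h0 h1 h2 h3 h4
  rw [h5, ← hC] at h4
  rw [← hf'] at h0
  generalize treeSeries (TreeAdmissible 1) = F1 at *
  generalize treeSeries (TreeAdmissible 2) = F2 at *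
  generalize treeSeries (TreeAdmissible 3) = F3 at *
  generalize treeSeries (TreeAdmissible 4) = F4 at *
  subst h4 h1
  have hF2 : (-PowerSeries.X ^ 2 * C + PowerSeries.X ^ 2 - 2 * PowerSeries.X + 1) * F2 =
      1 - PowerSeries.X * (1 + PowerSeries.X * (C - 1)) := by
    linear_combination (1 - PowerSeries.X * (1 + PowerSeries.X * (C - 1))) * h2 +
      PowerSeries.X * F2 * h3
  linear_combination (-PowerSeries.X ^ 2 * C + PowerSeries.X ^ 2 - 2 * PowerSeries.X + 1) * h0 +
    PowerSeries.X ^ 2 * f * hF2
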